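/- For 0 < s < 1 one has φ(s) > 0 and φ(s) + s φ'(s) ≥ 0. Consequently, for every v ∈ ℝ³ with 0 < |v| < 1, the symmetric 3×3 matrix m_f(v) defined by m_f(v)w = 3m_e (φ(|v|)w + |v|^{−1}φ'(|v|)(v·w)v) is positive semidefinite, and hence (m(v)w)·w ≥ (m₀(v)w)·w = γ(v)|w|² + γ(v)³(v·w)² for all w ∈ ℝ³. -/

import Mathlib

open Real MeasureTheory Filter
open scoped RealInnerProductSpace

noncomputable section

abbrev E3 : Type := EuclideanSpace ℝ (Fin 3)

/-- relativistic factor γ(v) = (1 - |v|²)^{-1/2} -/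
def gam (v : E3) : ℝ := (Real.sqrt (1 - ‖v‖ ^ 2))⁻¹

/-- the function appearing in the square brackets of the soliton momentum -/
def phiFun (s : ℝ) : ℝ :=
  if s = 0 then 1 / 3
  else 1 / (2 * s ^ 2 * (1 - s ^ 2)) - (1 / (4 * s ^ 3)) * Real.log ((1 + s) / (1 - s))

/-- m₀(v)w = γ w + γ³ (v·w) v -/
def m0Vec (v w : E3) : E3 := gam v • w + (gam v ^ 3 * ⟪v, w⟫) • v

/-- m_f(v)w = 3 mₑ (φ(|v|) w + |v|⁻¹ φ'(|v|)(v·w) v), equal to mₑ • w at v = 0 -/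
def mfVec (me : ℝ) (v w : E3) : E3 :=
  (3 * me * phiFun ‖v‖) • w + (3 * me * ‖v‖⁻¹ * deriv phiFun ‖v‖ * ⟪v, w⟫) • v

/-- m(v) = m₀(v) + m_f(v) -/
def mVec (me : ℝ) (v w : E3) : E3 := m0Vec v w + mfVec me v w

/-- a(v)w = (e²/12π)[γ⁴ w + 4 γ⁶ (v·w) v] -/
def aVec (e : ℝ) (v w : E3) : E3 :=
  (e ^ 2 / (12 * π)) • (gam v ^ 4 • w + (4 * gam v ^ 6 * ⟪v, w⟫) • v)

/-- b(v,w) = (e²/4π)[2γ⁶(v·w)w + γ⁶|w|²v + 6γ⁸(v·w)²v] -/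
def bVec (e : ℝ) (v w : E3) : E3 :=
  (e ^ 2 / (4 * π)) •
    ((2 * gam v ^ 6 * ⟪v, w⟫) • w + (gam v ^ 6 * ‖w‖ ^ 2) • v
      + (6 * gam v ^ 8 * ⟪v, w⟫ ^ 2) • v)

/-- soliton energy ℰ_s(v), extended by ℰ_s(0) = 0 -/
def Es (me : ℝ) (v : E3) : ℝ :=
  if ‖v‖ = 0 then 0
  else gam v - 1 + 3 * me * ((2 - ‖v‖ ^ 2) / (2 * (1 - ‖v‖ ^ 2))
    - (1 / (2 * ‖v‖)) * Real.log ((1 + ‖v‖) / (1 - ‖v‖)))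

/-- `log x < (x - x⁻¹) / 2` at `x = (1 + s) / (1 - s)`. -/
theorem log_one_add_div_one_sub_lt {s : ℝ} (h0 : 0 < s) (h1 : s < 1) :
    Real.log ((1 + s) / (1 - s)) < 2 * s / (1 - s ^ 2) := by
  have hs : 0 < 1 - s := by linarith
  have hs' : 0 < 1 + s := by linarith
  have hsq : 1 - s ^ 2 = (1 - s) * (1 + s) := by ring
  have hx : 1 < (1 + s) / (1 - s) := by rw [lt_div_iff₀ hs]; linarith
  have h := Real.self_lt_sinh_iff.2 (Real.log_pos hx)
  rw [Real.sinh_log (by positivity)] at h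
  convert h using 1
  rw [hsq]
  field_simp
  ring

/-- The first-order lower bound for `log ((1 + s) / (1 - s))`. -/
theorem two_mul_le_log_one_add_div_one_sub {s : ℝ} (h0 : 0 < s) (h1 : s < 1) :
    2 * s ≤ Real.log ((1 + s) / (1 - s)) := by
  have hs : 0 < 1 - s := by linarith
  have h := Real.le_log_one_add_of_nonneg (x := 2 * s / (1 - s)) (by positivity)
  have e1 : 1 + 2 * s / (1 - s) = (1 + s) / (1 - s) := by field_simp; ring
  have e2 : 2 * (2 * s / (1 - s)) / (2 * s / (1 - s) + 2) = 2 * s := by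
    have : 2 * s / (1 - s) + 2 = 2 / (1 - s) := by field_simp; ring
    rw [this]
    field_simp
  rwa [e1, e2] at h

theorem phiFun_pos {s : ℝ} (h0 : 0 < s) (h1 : s < 1) : 0 < phiFun s := by
  have hs : 0 < 1 - s ^ 2 := by nlinarith
  have h := log_one_add_div_one_sub_lt h0 h1
  rw [phiFun, if_neg h0.ne', sub_pos]
  calc 1 / (4 * s ^ 3) * Real.log ((1 + s) / (1 - s))
      < 1 / (4 * s ^ 3) * (2 * s / (1 - s ^ 2)) := by gcongr
    _ = 1 / (2 * s ^ 2 * (1 - s ^ 2)) := by field_simp; norm_num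

theorem hasDerivAt_phiFun {s : ℝ} (h0 : 0 < s) (h1 : s < 1) :
    HasDerivAt phiFun (-(1 - 2 * s ^ 2) / (s ^ 3 * (1 - s ^ 2) ^ 2)
      - 1 / (2 * s ^ 3 * (1 - s ^ 2))
      + 3 / (4 * s ^ 4) * Real.log ((1 + s) / (1 - s))) s := by
  have hs : 1 - s ≠ 0 := by linarith
  have hs' : 1 + s ≠ 0 := by linarith
  have hs2 : 1 - s ^ 2 ≠ 0 := by nlinarith
  have hsq : 1 - s ^ 2 = (1 - s) * (1 + s) := by ring
  have hid := hasDerivAt_id' s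
  have hpow := (hasDerivAt_pow 2 s).const_sub 1
  have hden := ((hasDerivAt_pow 2 s).const_mul 2).mul hpow
  have hA := (hasDerivAt_const s (1 : ℝ)).div hden
    (mul_ne_zero (mul_ne_zero two_ne_zero (pow_ne_zero 2 h0.ne')) hs2)
  have hB := (hasDerivAt_const s (1 : ℝ)).div ((hasDerivAt_pow 3 s).const_mul 4)
    (mul_ne_zero four_ne_zero (pow_ne_zero 3 h0.ne'))
  have hL := ((hid.const_add 1).div (hid.const_sub 1) hs).log (div_ne_zero hs' hs)
  refine ((hA.sub (hB.mul hL)).congr_of_eventuallyEq ?_).congr_deriv ?_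
  · filter_upwards [eventually_ne_nhds h0.ne'] with x hx
    rw [phiFun, if_neg hx]
    rfl
  · have h0' := h0.ne'
    simp only [Pi.mul_apply, Pi.div_apply]
    generalize Real.log _ = l
    rw [hsq]
    field_simp
    ring

theorem phiFun_add_mul_deriv_nonneg {s : ℝ} (h0 : 0 < s) (h1 : s < 1) :
    0 ≤ phiFun s + s * deriv phiFun s := by
  have hs : 0 < 1 - s ^ 2 := by nlinarith
  have hlog := two_mul_le_log_one_add_div_one_sub h0 h1
  rw [(hasDerivAt_phiFun h0 h1).deriv, phiFun, if_neg h0.ne']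
  generalize Real.log _ = l at *
  have key : 1 / (2 * s ^ 2 * (1 - s ^ 2)) - 1 / (4 * s ^ 3) * l
      + s * (-(1 - 2 * s ^ 2) / (s ^ 3 * (1 - s ^ 2) ^ 2) - 1 / (2 * s ^ 3 * (1 - s ^ 2))
        + 3 / (4 * s ^ 4) * l)
      = (l - 2 * s) / (2 * s ^ 3) + s ^ 2 / (1 - s ^ 2) ^ 2 := by
    field_simp
    ring
  rw [key]
  have : 0 ≤ l - 2 * s := by linarith
  positivity

theorem inner_smul_add_smul_self (a b : ℝ) (v w : E3) :
    ⟪a • w + (b * ⟪v, w⟫) • v, w⟫ = a * ‖w‖ ^ 2 + b * ⟪v, w⟫ ^ 2 := by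
  rw [inner_add_left, real_inner_smul_left, real_inner_smul_left, real_inner_self_eq_norm_sq]
  ring

theorem inner_mfVec_self_nonneg {me : ℝ} (hme : 0 ≤ me) {v : E3} (h0 : 0 < ‖v‖)
    (h1 : ‖v‖ < 1) (w : E3) : 0 ≤ ⟪mfVec me v w, w⟫ := by
  have hφ := phiFun_pos h0 h1
  have hφ' := phiFun_add_mul_deriv_nonneg h0 h1
  have hcs : ⟪v, w⟫ ^ 2 / ‖v‖ ^ 2 ≤ ‖w‖ ^ 2 := by
    rw [div_le_iff₀ (by positivity), ← mul_pow, mul_comm, ← sq_abs ⟪v, w⟫]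
    gcongr
    exact abs_real_inner_le_norm v w
  rw [mfVec, inner_smul_add_smul_self]
  have key : 3 * me * phiFun ‖v‖ * ‖w‖ ^ 2 + 3 * me * ‖v‖⁻¹ * deriv phiFun ‖v‖ * ⟪v, w⟫ ^ 2
      = 3 * me * (phiFun ‖v‖ * (‖w‖ ^ 2 - ⟪v, w⟫ ^ 2 / ‖v‖ ^ 2)
        + (phiFun ‖v‖ + ‖v‖ * deriv phiFun ‖v‖) * (⟪v, w⟫ ^ 2 / ‖v‖ ^ 2)) := by
    field_simp
    ring
  rw [key]
  have := sub_nonneg.2 hcs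
  positivity

/-- for 0 < s < 1, φ(s) > 0 and φ(s) + sφ'(s) ≥ 0; consequently for
0 < |v| < 1 the matrix m_f(v) is positive semidefinite, and hence
(m(v)w)·w ≥ (m₀(v)w)·w = γ|w|² + γ³(v·w)² for all w. -/
theorem mf_positive_semidefinite
    (me : ℝ) (hme : 0 ≤ me) :
    (∀ s : ℝ, 0 < s → s < 1 → 0 < phiFun s ∧ 0 ≤ phiFun s + s * deriv phiFun s)
    ∧ ∀ v : E3, 0 < ‖v‖ → ‖v‖ < 1 → ∀ w : E3,
        0 ≤ ⟪mfVec me v w, w⟫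
        ∧ ⟪m0Vec v w, w⟫ = gam v * ‖w‖ ^ 2 + gam v ^ 3 * ⟪v, w⟫ ^ 2
        ∧ ⟪m0Vec v w, w⟫ ≤ ⟪mVec me v w, w⟫ := by
  refine ⟨fun s h0 h1 => ⟨phiFun_pos h0 h1, phiFun_add_mul_deriv_nonneg h0 h1⟩,
    fun v h0 h1 w => ?_⟩
  have hmf := inner_mfVec_self_nonneg hme h0 h1 w
  refine ⟨hmf, inner_smul_add_smul_self _ _ v w, ?_⟩
  rw [mVec, inner_add_left]
  linarith
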